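/- arXiv:2005.11351 — 2 statements merged into one kernel-verified Lean document; each statement's English description precedes it below -/
import Mathlib

section
/- Let k be a field and s a positive integer. Let A = (α_{ij}) be an s×s symmetric matrix with entries in k whose rank equals s−1. Assume there exists a vector λ = (λ₁,…,λ_s) ∈ k^s such that the row-vector–matrix product λA is the zero vector and λ_i ≠ 0 for every i = 1,…,s. Then for every index ℓ ∈ {1,…,s}, the diagonal minor Δ_ℓ = det((α_{ij})_{i,j ∈ {1,…,s}∖{ℓ}}), i.e. the determinant of the (s−1)×(s−1) matrix obtained from A by deleting the ℓ-th row and the ℓ-th column, is nonzero. -/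
/-- If `A` is square of size `n + 1` and rank `n`, its kernel is spanned by any of its nonzero
elements. -/
theorem Matrix.exists_smul_eq_of_mulVec_eq_zero_of_rank_eq {k : Type*} [Field k] {n : ℕ}
    {A : Matrix (Fin (n + 1)) (Fin (n + 1)) k} (hrank : A.rank = n)
    {v w : Fin (n + 1) → k} (hv0 : v ≠ 0) (hv : A.mulVec v = 0) (hw : A.mulVec w = 0) :
    ∃ c : k, c • v = w := by
  have hker : Module.finrank k (LinearMap.ker A.mulVecLin) = 1 := by
    have h := A.mulVecLin.finrank_range_add_finrank_ker
    rw [Module.finrank_fin_fun] at h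
    change A.rank + _ = _ at h
    omega
  have hne : (⟨v, hv⟩ : LinearMap.ker A.mulVecLin) ≠ 0 := fun h => hv0 (congrArg Subtype.val h)
  obtain ⟨c, hc⟩ := (finrank_eq_one_iff_of_nonzero' _ hne).1 hker ⟨w, hw⟩
  exact ⟨c, congrArg Subtype.val hc⟩

/-- Let `v` be a vector annihilated by the matrix obtained from `A` by deleting the `ℓ`-th row
and column. If `lam` is in the left kernel of `A` and its `ℓ`-th entry is nonzero, then the
extension of `v` by zero at `ℓ` is annihilated by `A`. -/
theorem Matrix.mulVec_insertNth_zero_eq_zero {k : Type*} [Field k] {n : ℕ}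
    {A : Matrix (Fin (n + 1)) (Fin (n + 1)) k} {lam : Fin (n + 1) → k}
    (hlam : Matrix.vecMul lam A = 0) {ℓ : Fin (n + 1)} (hℓ : lam ℓ ≠ 0) {v : Fin n → k}
    (hv : (A.submatrix ℓ.succAbove ℓ.succAbove).mulVec v = 0) :
    A.mulVec (ℓ.insertNth (α := fun _ => k) 0 v) = 0 := by
  set w : Fin (n + 1) → k := ℓ.insertNth (α := fun _ => k) 0 v with hw
  have hrow (i : Fin n) : A.mulVec w (ℓ.succAbove i) = 0 := by
    have h := congrFun hv i
    simpa [Matrix.mulVec, dotProduct, Fin.sum_univ_succAbove _ ℓ, hw] using h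
  have hdot : lam ⬝ᵥ A.mulVec w = 0 := by
    rw [Matrix.dotProduct_mulVec, hlam, zero_dotProduct]
  have hrowℓ : A.mulVec w ℓ = 0 := by
    simpa [dotProduct, Fin.sum_univ_succAbove _ ℓ, hrow, hℓ] using hdot
  funext i
  exact Fin.succAboveCases ℓ hrowℓ hrow i

/-- Let `k` be a field and `A` a symmetric `(n+1) × (n+1)` matrix over `k` of rank `n`.
If there is a vector `lam` with `lam ⬝ A = 0` whose entries are all nonzero, then
every diagonal minor (deleting the `ℓ`-th row and `ℓ`-th column) of `A` is nonzero. -/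
theorem stmt_0 {k : Type*} [Field k] {n : ℕ}
    (A : Matrix (Fin (n + 1)) (Fin (n + 1)) k)
    (hsym : A.IsSymm) (hrank : A.rank = n)
    (lam : Fin (n + 1) → k)
    (hlam : Matrix.vecMul lam A = 0)
    (hne : ∀ i, lam i ≠ 0) :
    ∀ ℓ : Fin (n + 1), (A.submatrix ℓ.succAbove ℓ.succAbove).det ≠ 0 := by
  intro ℓ hdet
  obtain ⟨v, hv0, hv⟩ := Matrix.exists_mulVec_eq_zero_iff.2 hdet
  have hlam' : A.mulVec lam = 0 := by rw [← Matrix.vecMul_transpose, hsym.eq, hlam]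
  obtain ⟨c, hc⟩ := Matrix.exists_smul_eq_of_mulVec_eq_zero_of_rank_eq hrank
    (fun h => hne ℓ (congrFun h ℓ)) hlam' (Matrix.mulVec_insertNth_zero_eq_zero hlam (hne ℓ) hv)
  have hc0 : c = 0 := by simpa [hne ℓ] using congrFun hc ℓ
  refine hv0 (funext fun i => ?_)
  simpa [hc0] using (congrFun hc (ℓ.succAbove i)).symm
end

section
/- Call a tuple λ = (λ₁,…,λ_s) of complex numbers non-resonant if Σ_{i=1}^s m_iλ_i ≠ 0 for every tuple (m₁,…,m_s) of nonnegative integers that are not all zero. Let λ be non-resonant and let γ₁,…,γ_s : ℂ → ℂ be functions analytic at 0 with γ_i(0) = 0 and with nonzero germ at 0 for every i. Then the function z ↦ Σ_{i=1}^s λ_i · γ_i′(z)/γ_i(z) is not identically zero on any punctured neighbourhood of 0; that is, it is not the case that Σ_{i=1}^s λ_i γ_i′(z)/γ_i(z) = 0 for all z ≠ 0 sufficiently close to 0. -/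
open Filter

/-- If `f` is analytic at `z₀` with nonzero germ there, then `(z - z₀) * f' z / f z` tends to
a natural number, the order of vanishing of `f` at `z₀`, as `z → z₀` with `z ≠ z₀`. -/
theorem AnalyticAt.exists_tendsto_sub_mul_logDeriv {f : ℂ → ℂ} {z₀ : ℂ} (hf : AnalyticAt ℂ f z₀)
    (hne : ¬ ∀ᶠ z in nhds z₀, f z = 0) :
    ∃ n : ℕ, (f z₀ = 0 → n ≠ 0) ∧
      Tendsto (fun z ↦ (z - z₀) * logDeriv f z) (nhdsWithin z₀ {z₀}ᶜ) (nhds (n : ℂ)) := by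
  obtain ⟨n, g, hg, hg0, hfg⟩ := hf.exists_eventuallyEq_pow_smul_nonzero_iff.mpr hne
  refine ⟨n, ?_, ?_⟩
  · rintro hf0 rfl
    exact hg0 (by simpa [hf0] using hfg.self_of_nhds.symm)
  have hlim : Tendsto (fun z ↦ (n : ℂ) + (z - z₀) * logDeriv g z)
      (nhdsWithin z₀ {z₀}ᶜ) (nhds (n : ℂ)) := by
    have hc : ContinuousAt (fun z ↦ (n : ℂ) + (z - z₀) * (deriv g z / g z)) z₀ :=
      continuousAt_const.add ((continuousAt_id.sub continuousAt_const).mul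
        (hg.deriv.continuousAt.div hg.continuousAt hg0))
    simpa [logDeriv_apply] using hc.tendsto.mono_left nhdsWithin_le_nhds
  refine hlim.congr' ?_
  filter_upwards [self_mem_nhdsWithin, nhdsWithin_le_nhds hfg.eventually_nhds,
    nhdsWithin_le_nhds (hg.continuousAt.eventually_ne hg0),
    nhdsWithin_le_nhds hg.eventually_analyticAt] with z hz hfz hgz hgan
  have hz' : z - z₀ ≠ 0 := sub_ne_zero.mpr hz
  have hd : DifferentiableAt ℂ (fun w : ℂ ↦ w - z₀) z := by fun_prop
  have hfun : f =ᶠ[nhds z] fun w ↦ (w - z₀) ^ n * g w := hfz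
  rw [(logDeriv_congr_nhds hfun).self_of_nhds,
    logDeriv_mul (f := fun w ↦ (w - z₀) ^ n) z (pow_ne_zero n hz') hgz (hd.pow n)
      hgan.differentiableAt,
    logDeriv_fun_pow hd]
  simp only [logDeriv_apply, deriv_sub_const, deriv_id'']
  field_simp

/-- Let `λ = (λ₁, …, λ_s)` be a non-resonant tuple of complex numbers (no nontrivial
nonnegative-integer combination of the `λ i` vanishes), and let `γ₁, …, γ_s : ℂ → ℂ` be
analytic at `0`, vanishing at `0`, each with nonzero germ at `0`.  Then the function
`z ↦ ∑ i, λ i * γ i ' z / γ i z` is not identically zero on any punctured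
neighbourhood of `0`. -/
theorem stmt_4 {s : ℕ} (hs : 0 < s) (lam : Fin s → ℂ)
    (hres : ∀ m : Fin s → ℕ, m ≠ 0 → ∑ i, (m i : ℂ) * lam i ≠ 0)
    (γ : Fin s → ℂ → ℂ) (h : ∀ i, AnalyticAt ℂ (γ i) 0)
    (h0 : ∀ i, γ i 0 = 0)
    (hne : ∀ i, ¬ (∀ᶠ z in nhds (0 : ℂ), γ i z = 0)) :
    ¬ (∀ᶠ z in nhdsWithin 0 {(0 : ℂ)}ᶜ, ∑ i, lam i * deriv (γ i) z / γ i z = 0) := by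
  intro hzero
  choose n hn hlim using fun i ↦ (h i).exists_tendsto_sub_mul_logDeriv (hne i)
  have hsum : Tendsto (fun z ↦ ∑ i, ((z - 0) * logDeriv (γ i) z) * lam i)
      (nhdsWithin 0 {(0 : ℂ)}ᶜ) (nhds (∑ i, (n i : ℂ) * lam i)) :=
    tendsto_finsetSum _ fun i _ ↦ (hlim i).mul_const (lam i)
  refine hres n (fun hn0 ↦ hn ⟨0, hs⟩ (h0 _) (congrFun hn0 _))
    (tendsto_nhds_unique (hsum.congr' ?_) tendsto_const_nhds)
  filter_upwards [hzero] with z hz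
  calc ∑ i, ((z - 0) * logDeriv (γ i) z) * lam i
      = z * ∑ i, lam i * deriv (γ i) z / γ i z := by
        rw [Finset.mul_sum]
        refine Finset.sum_congr rfl fun i _ ↦ ?_
        rw [logDeriv_apply, sub_zero]
        ring
    _ = 0 := by rw [hz, mul_zero]
end
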